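/- There exists a subgroup G ≤ W isomorphic to the Frobenius group F₅ of order 20 (the semidirect product C₅ ⋊ C₄ with C₄ acting faithfully on C₅) such that: the action of G on the 240 exceptional classes has exactly 18 orbits, with orbit-length multiset consisting of five orbits of length 4, four of length 10, and nine of length 20; G is minimal; G fixes a conic class; and G satisfies condition (H1). -/

import Mathlib

open scoped BigOperators

noncomputable section

/-- The Picard lattice of a degree 1 del Pezzo surface. -/
abbrev V : Type := Fin 9 → ℤ

/-- The intersection form. -/
def bil (x y : V) : ℤ := x 0 * y 0 - ∑ i ∈ Finset.Ioi (0 : Fin 9), x i * y i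

/-- The canonical class. -/
def Kvec : V := fun i => if i = 0 then -3 else 1

abbrev LatAut := V ≃ₗ[ℤ] V

/-- The Weyl group: automorphisms preserving the form and fixing K. -/
def W : Subgroup LatAut where
  carrier := {g | (∀ x y, bil (g x) (g y) = bil x y) ∧ g Kvec = Kvec}
  one_mem' := ⟨fun _ _ => rfl, rfl⟩
  mul_mem' := by
    rintro a b ⟨ha1, ha2⟩ ⟨hb1, hb2⟩
    refine ⟨fun x y => ?_, ?_⟩
    · show bil (a (b x)) (a (b y)) = bil x y
      rw [ha1, hb1]
    · show a (b Kvec) = Kvec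
      rw [hb2, ha2]
  inv_mem' := by
    rintro a ⟨ha1, ha2⟩
    refine ⟨fun x y => ?_, ?_⟩
    · have h := ha1 (a⁻¹ x) (a⁻¹ y)
      have hx : a (a⁻¹ x) = x := a.apply_symm_apply x
      have hy : a (a⁻¹ y) = y := a.apply_symm_apply y
      rw [hx, hy] at h
      exact h.symm
    · have h2 : a.symm (a Kvec) = a.symm Kvec := by rw [ha2]
      rw [a.symm_apply_apply] at h2
      exact (show a⁻¹ Kvec = a.symm Kvec from rfl).trans h2.symm

/-- Exceptional classes. -/
def Exc : Set V := {E | bil E E = -1 ∧ bil E Kvec = -1}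

/-- Conic classes. -/
def IsConic (C : V) : Prop := bil C C = 0 ∧ bil C Kvec = -2

/-- The orbit of a vector under a subgroup of `LatAut`. -/
def orb (G : Subgroup LatAut) (E : V) : Set V := {v | ∃ g ∈ G, g E = v}

/-- The set of orbits of exceptional classes. -/
def orbs (G : Subgroup LatAut) : Set (Set V) := {S | ∃ E ∈ Exc, S = orb G E}

/-- The stabilizer of a vector, as a subgroup of `LatAut`. -/
def stab (G : Subgroup LatAut) (E : V) : Subgroup LatAut where
  carrier := {g | g ∈ G ∧ g E = E}
  one_mem' := ⟨G.one_mem, rfl⟩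
  mul_mem' := by
    rintro a b ⟨haG, ha⟩ ⟨hbG, hb⟩
    exact ⟨G.mul_mem haG hbG, by show a (b E) = E; rw [hb, ha]⟩
  inv_mem' := by
    rintro a ⟨haG, ha⟩
    refine ⟨G.inv_mem haG, ?_⟩
    conv_lhs => rw [← ha]
    exact a.symm_apply_apply E

/-- `G` is minimal: no nonempty orbit of exceptional classes consists of pairwise
orthogonal classes. -/
def MinimalAction (G : Subgroup LatAut) : Prop :=
  ∀ E ∈ Exc, ¬ (∀ E₁ ∈ orb G E, ∀ E₂ ∈ orb G E, E₁ ≠ E₂ → bil E₁ E₂ = 0)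

/-- The natural representation of a subgroup of `LatAut` on the lattice. -/
def rep (G : Subgroup LatAut) : Representation ℤ G V where
  toFun g := (g : LatAut).toLinearMap
  map_one' := rfl
  map_mul' _ _ := rfl

/-- Condition (H1): the first group cohomology of every subgroup of `G`
with coefficients in the lattice vanishes. -/
def CondH1 (G : Subgroup LatAut) : Prop :=
  ∀ G' : Subgroup LatAut, G' ≤ G →
    Subsingleton (groupCohomology.H1 (Rep.of (rep G')))

/-! ### The form and the exceptional classes in coordinates -/

theorem bil_eq_sum (x y : V) : bil x y = x 0 * y 0 - ∑ i : Fin 8, x i.succ * y i.succ := by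
  have h : Finset.Ioi (0 : Fin 9) = Finset.univ.map (Fin.succEmb 8) := by decide
  simp [bil, h]

theorem bil_eq (x y : V) : bil x y = x 0 * y 0 - (x 1 * y 1 + x 2 * y 2 + x 3 * y 3 + x 4 * y 4 +
    x 5 * y 5 + x 6 * y 6 + x 7 * y 7 + x 8 * y 8) := by
  rw [bil_eq_sum, Fin.sum_univ_eight]
  rfl

/-- The integer vectors of length `n` with entries in `[-3, 1]`, sum `s` and
sum of squares `q`. -/
def vectorsWithSums : (n : ℕ) → ℤ → ℤ → List (Fin n → ℤ)
  | 0, s, q => if s = 0 ∧ q = 0 then [![]] else []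
  | n + 1, s, q =>
    if s * s ≤ (n + 1) * q then
      [-3, -2, -1, 0, 1].flatMap fun a =>
        (vectorsWithSums n (s - a) (q - a * a)).map (Matrix.vecCons a)
    else []

theorem mem_vectorsWithSums {n : ℕ} (v : Fin n → ℤ) {s q : ℤ}
    (hb : ∀ i, -3 ≤ v i ∧ v i ≤ 1)
    (hs : ∑ i, v i = s) (hv : ∑ i, v i ^ 2 = q) : v ∈ vectorsWithSums n s q := by
  induction n generalizing s q with
  | zero =>
    simp only [Finset.univ_eq_empty, Finset.sum_empty] at hs hv
    simp [vectorsWithSums, ← hs, ← hv, Subsingleton.elim v ![]]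
  | succ n ih =>
    have hcs : s * s ≤ (n + 1) * q := by
      have := sq_sum_le_card_mul_sum_sq (s := Finset.univ) (f := v)
      rw [hs, hv] at this
      simpa [sq] using this
    rw [Fin.sum_univ_succ] at hs hv
    have hmem : v 0 ∈ [-3, -2, -1, 0, (1 : ℤ)] := by
      have := hb 0
      simp only [List.mem_cons, List.not_mem_nil, or_false]
      omega
    rw [vectorsWithSums, if_pos hcs, List.mem_flatMap]
    exact ⟨v 0, hmem, List.mem_map.2 ⟨fun i => v i.succ,
      ih _ (fun i => hb i.succ) (by linarith) (by linarith), Matrix.cons_head_tail v⟩⟩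

/-- The list of the exceptional classes. -/
def excList : List V :=
  [-1, 0, 1, 2, 3, 4, 5, 6, 7].flatMap fun d =>
    (vectorsWithSums 8 (1 - 3 * d) (d * d + 1)).map (Matrix.vecCons d)

theorem mem_excList {E : V} (hE : E ∈ Exc) : E ∈ excList := by
  obtain ⟨h₁, h₂⟩ := hE
  rw [bil_eq_sum] at h₁ h₂
  have hsum : ∑ i : Fin 8, E i.succ = 1 - 3 * E 0 := by
    simp [Kvec, Fin.succ_ne_zero] at h₂
    linarith
  have hsq : ∑ i : Fin 8, E i.succ ^ 2 = E 0 * E 0 + 1 := by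
    simp only [sq]
    linarith
  have hcs := sq_sum_le_card_mul_sum_sq (s := Finset.univ) (f := fun i : Fin 8 => E i.succ)
  rw [hsum, hsq] at hcs
  simp only [Finset.card_univ, Fintype.card_fin, Nat.cast_ofNat] at hcs
  have hlow : -1 ≤ E 0 := by nlinarith
  have hupp : E 0 ≤ 7 := by nlinarith
  have hmem : E 0 ∈ [-1, 0, 1, 2, 3, 4, 5, 6, (7 : ℤ)] := by
    simp only [List.mem_cons, List.not_mem_nil, or_false]
    omega
  rw [excList, List.mem_flatMap]
  refine ⟨E 0, hmem, List.mem_map.2 ⟨fun i => E i.succ,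
    mem_vectorsWithSums _ (fun i => ?_) hsum hsq, Matrix.cons_head_tail E⟩⟩
  have hsum' := Finset.add_sum_erase Finset.univ (fun i : Fin 8 => E i.succ) (Finset.mem_univ i)
  have hsq' :=
    Finset.add_sum_erase Finset.univ (fun i : Fin 8 => E i.succ ^ 2) (Finset.mem_univ i)
  have hcs' := sq_sum_le_card_mul_sum_sq (s := Finset.univ.erase i) (f := fun i => E i.succ)
  rw [hsum] at hsum'
  rw [hsq] at hsq'
  rw [← eq_sub_iff_add_eq'] at hsum' hsq'
  rw [hsum', hsq'] at hcs'
  simp only [Finset.card_erase_of_mem, Finset.mem_univ, Finset.card_univ, Fintype.card_fin,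
    Nat.add_one_sub_one, Nat.cast_ofNat] at hcs'
  have key : (E i.succ + 3) * (E i.succ - 1) ≤ 0 := by
    nlinarith [sq_nonneg (2 * E 0 + 3 * E i.succ - 3)]
  constructor <;> nlinarith

/-! ### The generators -/

/-- The isometry permuting `E₂, …, E₆` cyclically and fixing the other basis vectors. -/
def rot : LatAut where
  toFun x := ![x 0, x 1, x 6, x 2, x 3, x 4, x 5, x 7, x 8]
  invFun x := ![x 0, x 1, x 3, x 4, x 5, x 6, x 2, x 7, x 8]
  map_add' x y := by ext i; fin_cases i <;> simp
  map_smul' c x := by ext i; fin_cases i <;> simp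
  left_inv x := by ext i; fin_cases i <;> simp
  right_inv x := by ext i; fin_cases i <;> simp

/-- With `C = L - E₁`, the isometry fixing `C` and mapping `E_{2+k}` to `C - E_{2+2k}`
(indices `k` modulo `5`), `E₇` to `E₈` and `E₈` to `C - E₇`. -/
def twist : LatAut where
  toFun x := ![4 * x 0 + 3 * x 1 + (x 2 + x 3 + x 4 + x 5 + x 6) + x 8,
    -3 * x 0 - 2 * x 1 - (x 2 + x 3 + x 4 + x 5 + x 6) - x 8,
    -x 0 - x 1 - x 2, -x 0 - x 1 - x 5, -x 0 - x 1 - x 3, -x 0 - x 1 - x 6, -x 0 - x 1 - x 4,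
    -x 0 - x 1 - x 8, x 7]
  invFun x := ![4 * x 0 + 3 * x 1 + (x 2 + x 3 + x 4 + x 5 + x 6) + x 7,
    -3 * x 0 - 2 * x 1 - (x 2 + x 3 + x 4 + x 5 + x 6) - x 7,
    -x 0 - x 1 - x 2, -x 0 - x 1 - x 4, -x 0 - x 1 - x 6, -x 0 - x 1 - x 3, -x 0 - x 1 - x 5,
    x 8, -x 0 - x 1 - x 7]
  map_add' x y := by ext i; fin_cases i <;> simp <;> ring
  map_smul' c x := by ext i; fin_cases i <;> simp <;> ring
  left_inv x := by ext i; fin_cases i <;> simp <;> ring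
  right_inv x := by ext i; fin_cases i <;> simp <;> ring

theorem rot_apply (x : V) : rot x = ![x 0, x 1, x 6, x 2, x 3, x 4, x 5, x 7, x 8] := rfl

theorem twist_apply (x : V) :
    twist x = ![4 * x 0 + 3 * x 1 + (x 2 + x 3 + x 4 + x 5 + x 6) + x 8,
      -3 * x 0 - 2 * x 1 - (x 2 + x 3 + x 4 + x 5 + x 6) - x 8,
      -x 0 - x 1 - x 2, -x 0 - x 1 - x 5, -x 0 - x 1 - x 3, -x 0 - x 1 - x 6, -x 0 - x 1 - x 4,
      -x 0 - x 1 - x 8, x 7] := rfl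

theorem twist_inv_apply (x : V) :
    twist⁻¹ x = ![4 * x 0 + 3 * x 1 + (x 2 + x 3 + x 4 + x 5 + x 6) + x 7,
      -3 * x 0 - 2 * x 1 - (x 2 + x 3 + x 4 + x 5 + x 6) - x 7,
      -x 0 - x 1 - x 2, -x 0 - x 1 - x 4, -x 0 - x 1 - x 6, -x 0 - x 1 - x 3, -x 0 - x 1 - x 5,
      x 8, -x 0 - x 1 - x 7] := rfl

theorem twist_sq_apply (x : V) :
    (twist ^ 2) x = ![2 * x 0 + x 1 + x 7 + x 8, -x 0 - x 7 - x 8, x 2, x 6, x 5, x 4, x 3,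
      -x 0 - x 1 - x 7, -x 0 - x 1 - x 8] := by
  rw [sq, LinearEquiv.mul_apply]
  ext i
  fin_cases i <;> simp [twist_apply] <;> ring

theorem rot_pow_five : rot ^ 5 = 1 := by
  ext1 x
  ext i
  simp only [pow_succ, pow_zero, one_mul, LinearEquiv.mul_apply]
  fin_cases i <;> rfl

theorem twist_pow_four : twist ^ 4 = 1 := by
  ext1 x
  rw [show 4 = 2 * 2 from rfl, pow_mul, sq (twist ^ 2), LinearEquiv.mul_apply]
  ext i
  fin_cases i <;> simp [twist_sq_apply] <;> ring

theorem twist_mul_rot : twist * rot = rot ^ 2 * twist := by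
  ext1 x
  ext i
  simp only [sq, LinearEquiv.mul_apply]
  fin_cases i <;> simp [twist_apply, rot_apply] <;> ring

theorem rot_mem_W : rot ∈ W :=
  ⟨fun x y => by simp [bil_eq, rot_apply]; ring, by decide⟩

theorem twist_mem_W : twist ∈ W :=
  ⟨fun x y => by simp [bil_eq, twist_apply]; ring, by decide⟩

/-! ### The Frobenius group and its action -/

/-- The homomorphism from `ℤ/n` given by an element whose `n`-th power is trivial. -/
def zmodPow {M : Type*} [Monoid M] {n : ℕ} [NeZero n] (g : M) (hg : g ^ n = 1) :
    Multiplicative (ZMod n) →* M where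
  toFun a := g ^ a.toAdd.val
  map_one' := by simp
  map_mul' a b := by rw [toAdd_mul, ZMod.val_add, ← pow_eq_pow_mod _ hg, pow_add]

/-- Multiplication by `2 ^ b` on `ℤ/5`, for `b` in `ℤ/4`. -/
def doubling : Multiplicative (ZMod 4) →* MulAut (Multiplicative (ZMod 5)) where
  toFun b :=
    { toFun := fun a => a ^ 2 ^ b.toAdd.val
      invFun := fun a => a ^ 3 ^ b.toAdd.val
      left_inv := by revert b; decide
      right_inv := by revert b; decide
      map_mul' := fun _ _ => mul_pow _ _ _ }
  map_one' := by ext a; revert a; decide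
  map_mul' a b := by ext c; revert a b c; decide

theorem doubling_injective : Function.Injective doubling := by
  intro a b h
  have h1 := DFunLike.congr_fun h (Multiplicative.ofAdd 1)
  revert a b
  decide

/-- The Frobenius group of order `20`. -/
abbrev Frob := Multiplicative (ZMod 5) ⋊[doubling] Multiplicative (ZMod 4)

theorem twist_pow_mul_rot_pow (a b : ℕ) :
    twist ^ b * rot ^ a = rot ^ (2 ^ b * a) * twist ^ b := by
  induction b generalizing a with
  | zero => simp
  | succ b ih =>
    have h : SemiconjBy twist (rot ^ a) (rot ^ (2 * a)) := by
      rw [pow_mul]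
      exact SemiconjBy.pow_right twist_mul_rot a
    rw [pow_succ, mul_assoc, h.eq, ← mul_assoc, ih, mul_assoc, pow_succ, mul_assoc]

/-- The action of the Frobenius group on the lattice. -/
def frobHom : Frob →* LatAut :=
  SemidirectProduct.lift (zmodPow rot rot_pow_five) (zmodPow twist twist_pow_four) fun b => by
    refine MonoidHom.ext fun a => ?_
    have h : ((doubling b a).toAdd).val = (2 ^ b.toAdd.val * a.toAdd.val) % 5 := by
      revert a b
      decide
    change rot ^ ((doubling b a).toAdd).val = twist ^ b.toAdd.val * rot ^ a.toAdd.val *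
      (twist ^ b.toAdd.val)⁻¹
    rw [eq_mul_inv_iff_mul_eq, twist_pow_mul_rot_pow, h, ← pow_eq_pow_mod _ rot_pow_five]

/-- The element `frobHom ⟨a, b⟩` as an explicit map. -/
def explicitAction (a : ZMod 5) (b : ZMod 4) (x : V) : V :=
  (fun y => match a with
    | 0 => y
    | 1 => ![y 0, y 1, y 6, y 2, y 3, y 4, y 5, y 7, y 8]
    | 2 => ![y 0, y 1, y 5, y 6, y 2, y 3, y 4, y 7, y 8]
    | 3 => ![y 0, y 1, y 4, y 5, y 6, y 2, y 3, y 7, y 8]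
    | 4 => ![y 0, y 1, y 3, y 4, y 5, y 6, y 2, y 7, y 8])
  (match b with
    | 0 => x
    | 1 => ![4 * x 0 + 3 * x 1 + (x 2 + x 3 + x 4 + x 5 + x 6) + x 8,
        -3 * x 0 - 2 * x 1 - (x 2 + x 3 + x 4 + x 5 + x 6) - x 8,
        -x 0 - x 1 - x 2, -x 0 - x 1 - x 5, -x 0 - x 1 - x 3, -x 0 - x 1 - x 6, -x 0 - x 1 - x 4,
        -x 0 - x 1 - x 8, x 7]
    | 2 => ![2 * x 0 + x 1 + x 7 + x 8, -x 0 - x 7 - x 8, x 2, x 6, x 5, x 4, x 3,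
        -x 0 - x 1 - x 7, -x 0 - x 1 - x 8]
    | 3 => ![4 * x 0 + 3 * x 1 + (x 2 + x 3 + x 4 + x 5 + x 6) + x 7,
        -3 * x 0 - 2 * x 1 - (x 2 + x 3 + x 4 + x 5 + x 6) - x 7,
        -x 0 - x 1 - x 2, -x 0 - x 1 - x 4, -x 0 - x 1 - x 6, -x 0 - x 1 - x 3, -x 0 - x 1 - x 5,
        x 8, -x 0 - x 1 - x 7])

theorem frobHom_apply (q : Frob) (x : V) :
    frobHom q x = explicitAction q.left.toAdd q.right.toAdd x := by
  obtain ⟨a, b⟩ := q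
  have h3 : twist ^ 3 = twist⁻¹ := eq_inv_of_mul_eq_one_left twist_pow_four
  have hb : (twist ^ b.toAdd.val) x = explicitAction 0 b.toAdd x := by
    induction b using Multiplicative.rec with | _ b =>
    fin_cases b
    · rfl
    · rfl
    · exact twist_sq_apply x
    · change (twist ^ 3) x = _
      rw [h3]
      rfl
  change (rot ^ a.toAdd.val) ((twist ^ b.toAdd.val) x) = _
  rw [hb]
  induction a using Multiplicative.rec with | _ a =>
  fin_cases a
  · rfl
  · rfl
  · ext i; fin_cases i <;> rfl
  · ext i; fin_cases i <;> rfl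
  · ext i; fin_cases i <;> rfl

/-! ### Orbits of exceptional classes -/

/-- Representatives of the orbits of exceptional classes. -/
def orbitRep : Fin 18 → V := ![
  ![0, 0, 0, 0, 0, 0, 0, 0, 1], ![0, 1, 0, 0, 0, 0, 0, 0, 0], ![2, 0, -1, -1, -1, -1, -1, 0, 0],
  ![3, 0, -1, -1, -1, -1, -1, -1, -2], ![5, -1, -2, -2, -2, -2, -2, -1, -2],
  ![0, 0, 0, 0, 0, 0, 1, 0, 0], ![2, 0, 0, -1, 0, -1, -1, -1, -1],
  ![2, 0, 0, 0, -1, -1, -1, -1, -1], ![5, -1, -1, -2, -2, -2, -2, -2, -2],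
  ![1, 0, 0, 0, -1, 0, -1, 0, 0], ![1, 0, 0, 0, 0, -1, -1, 0, 0],
  ![1, 0, 0, 0, 0, 0, -1, 0, -1], ![2, 0, 0, -1, -1, -1, -1, -1, 0],
  ![2, 0, 0, -1, -1, -1, -1, 0, -1], ![3, -1, 0, -1, -1, -1, -2, -1, -1],
  ![3, 0, -1, -1, -1, -1, -2, -1, -1], ![4, -1, -1, -1, -2, -1, -2, -1, -2],
  ![4, -1, -1, -1, -1, -2, -2, -1, -2]]

theorem length_excList : excList.length = 240 := by
  decide +kernel

theorem orbitRep_mem_Exc (k : Fin 18) : orbitRep k ∈ Exc := by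
  constructor <;> rw [bil_eq] <;> revert k <;> decide +kernel

theorem explicitAction_orbitRep_ne :
    ∀ k, ∀ l < k, orbitRep k 0 + orbitRep k 1 = orbitRep l 0 + orbitRep l 1 →
      ∀ b a, explicitAction a b (orbitRep k) ≠ orbitRep l := by
  decide +kernel

/-- The length of the orbit of `orbitRep k`. -/
def orbitSize (k : Fin 18) : ℕ := if k < 5 then 4 else if k < 9 then 10 else 20

theorem card_fixing_orbitRep : ∀ k, (Finset.univ.filter fun p : ZMod 5 × ZMod 4 =>
    explicitAction p.1 p.2 (orbitRep k) = orbitRep k).card * orbitSize k = 20 := by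
  decide +kernel

theorem exists_bil_explicitAction_pos :
    ∀ k, ∃ b a, 1 ≤ bil (orbitRep k) (explicitAction a b (orbitRep k)) := by
  simp only [bil_eq]
  decide +kernel

/-- A conic class fixed by both generators. -/
def conic : V := ![1, -1, 0, 0, 0, 0, 0, 0, 0]

theorem isConic_conic : IsConic conic := by
  constructor <;> decide

theorem bil_conic (x : V) : bil x conic = x 0 + x 1 := by
  simp [bil_eq, conic]

theorem range_frobHom_le_stab : frobHom.range ≤ stab W conic := by
  rintro _ ⟨⟨a, b⟩, rfl⟩
  have hr : rot ∈ stab W conic := ⟨rot_mem_W, by decide⟩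
  have ht : twist ∈ stab W conic := ⟨twist_mem_W, by decide⟩
  exact mul_mem (pow_mem hr _) (pow_mem ht _)

theorem frobHom_mem_W (q : Frob) : frobHom q ∈ W := (range_frobHom_le_stab ⟨q, rfl⟩).1

theorem frobHom_conic (q : Frob) : frobHom q conic = conic := (range_frobHom_le_stab ⟨q, rfl⟩).2

theorem mem_orb_range {x y : V} : y ∈ orb frobHom.range x ↔ ∃ q, frobHom q x = y := by
  simp [orb]

theorem orb_eq_of_mem {G : Subgroup LatAut} {x y : V} (h : y ∈ orb G x) : orb G y = orb G x := by
  obtain ⟨g, hg, rfl⟩ := h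
  ext z
  constructor
  · rintro ⟨k, hk, rfl⟩
    exact ⟨k * g, mul_mem hk hg, rfl⟩
  · rintro ⟨k, hk, rfl⟩
    refine ⟨k * g⁻¹, mul_mem hk (inv_mem hg), ?_⟩
    exact congrArg k (g.symm_apply_apply x)

theorem mem_orb_self (G : Subgroup LatAut) (x : V) : x ∈ orb G x := ⟨1, one_mem G, rfl⟩

theorem orb_range_subset_Exc {x : V} (hx : x ∈ Exc) : orb frobHom.range x ⊆ Exc := by
  intro y hy
  obtain ⟨q, rfl⟩ := mem_orb_range.1 hy
  obtain ⟨hbil, hK⟩ := frobHom_mem_W q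
  exact ⟨(hbil x x).trans hx.1, by rw [← hK, hbil, hx.2]⟩

theorem ncard_orb_orbitRep (k : Fin 18) :
    (orb frobHom.range (orbitRep k)).ncard = orbitSize k := by
  let _ : MulAction Frob V := MulAction.compHom V frobHom
  have horb : orb frobHom.range (orbitRep k) = MulAction.orbit Frob (orbitRep k) := by
    ext y
    exact mem_orb_range
  have hcard : Nat.card Frob = 20 := by simp [Nat.card_eq_fintype_card, ZMod.card]
  have hstab : Nat.card (MulAction.stabilizer Frob (orbitRep k)) =
      (Finset.univ.filter fun p : ZMod 5 × ZMod 4 =>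
        explicitAction p.1 p.2 (orbitRep k) = orbitRep k).card := by
    rw [← Fintype.card_subtype, ← Nat.card_eq_fintype_card]
    refine Nat.card_congr ((SemidirectProduct.equivProd.trans
      (Multiplicative.toAdd.prodCongr Multiplicative.toAdd)).subtypeEquiv fun q => ?_)
    exact iff_of_eq (congrArg (· = orbitRep k) (frobHom_apply q (orbitRep k)))
  have h := (MulAction.stabilizer Frob (orbitRep k)).card_mul_index
  rw [MulAction.index_stabilizer, ← horb, hstab, hcard, ← card_fixing_orbitRep k] at h
  refine Nat.eq_of_mul_eq_mul_left (Nat.pos_of_ne_zero fun h0 => ?_) h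
  have := card_fixing_orbitRep k
  simp [h0] at this

theorem orb_orbitRep_injective :
    Function.Injective fun k => orb frobHom.range (orbitRep k) := by
  intro k l hkl
  by_contra hne
  wlog hlt : l < k generalizing k l
  · exact this hkl.symm (Ne.symm hne) (lt_of_le_of_ne (not_lt.1 hlt) hne)
  have hmem : orbitRep l ∈ orb frobHom.range (orbitRep k) := by
    have := mem_orb_self frobHom.range (orbitRep l)
    rwa [← show _ = orb frobHom.range (orbitRep l) from hkl] at this
  obtain ⟨q, hq⟩ := mem_orb_range.1 hmem
  refine explicitAction_orbitRep_ne k l hlt ?_ q.right.toAdd q.left.toAdd ?_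
  · rw [← bil_conic, ← bil_conic, ← hq, ← (frobHom_mem_W q).1, frobHom_conic]
  · rw [← frobHom_apply, hq]

theorem exists_mem_orb_orbitRep {E : V} (hE : E ∈ Exc) :
    ∃ k, E ∈ orb frobHom.range (orbitRep k) := by
  classical
  have hfin (k) : (orb frobHom.range (orbitRep k)).Finite :=
    Set.finite_of_ncard_pos (by rw [ncard_orb_orbitRep]; revert k; decide)
  set U : Finset V := Finset.univ.biUnion fun k => (hfin k).toFinset with hU
  have hcard : U.card = 240 := by
    rw [hU, Finset.card_biUnion]
    · simp only [← Set.ncard_eq_toFinset_card _ (hfin _), ncard_orb_orbitRep]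
      decide
    · intro k _ l _ hkl
      refine Finset.disjoint_left.2 fun x hx hx' => ?_
      rw [Set.Finite.mem_toFinset] at hx hx'
      exact hkl (orb_orbitRep_injective ((orb_eq_of_mem hx).symm.trans (orb_eq_of_mem hx')))
  have hsub : U ⊆ excList.toFinset := by
    intro x hx
    simp only [hU, Finset.mem_biUnion, Finset.mem_univ, true_and, Set.Finite.mem_toFinset] at hx
    obtain ⟨k, hk⟩ := hx
    exact List.mem_toFinset.2 (mem_excList (orb_range_subset_Exc (orbitRep_mem_Exc k) hk))
  have heq : U = excList.toFinset := Finset.eq_of_subset_of_card_le hsub <| by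
    rw [hcard, ← length_excList]
    exact excList.toFinset_card_le
  have hEU : E ∈ U := heq ▸ List.mem_toFinset.2 (mem_excList hE)
  simpa [hU] using hEU

theorem orbs_range_frobHom :
    orbs frobHom.range = Set.range fun k => orb frobHom.range (orbitRep k) := by
  ext S
  constructor
  · rintro ⟨E, hE, rfl⟩
    obtain ⟨k, hk⟩ := exists_mem_orb_orbitRep hE
    exact ⟨k, (orb_eq_of_mem hk).symm⟩
  · rintro ⟨k, rfl⟩
    exact ⟨orbitRep k, orbitRep_mem_Exc k, rfl⟩

theorem ncard_orbs : (orbs frobHom.range).ncard = 18 := by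
  rw [orbs_range_frobHom, ← Set.image_univ, Set.ncard_image_of_injective _ orb_orbitRep_injective,
    Set.ncard_univ, Nat.card_fin]

theorem ncard_orbs_of_size (n : ℕ) : {S ∈ orbs frobHom.range | S.ncard = n}.ncard =
    (Finset.univ.filter fun k => orbitSize k = n).card := by
  rw [← Set.ncard_coe_finset, ← Set.ncard_image_of_injective _ orb_orbitRep_injective]
  congr 1
  ext S
  simp only [orbs_range_frobHom, Set.mem_ofPred_eq, Set.mem_range, Set.mem_image,
    Finset.coe_filter, Finset.mem_univ, true_and]
  constructor
  · rintro ⟨⟨k, rfl⟩, hk⟩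
    exact ⟨k, (ncard_orb_orbitRep k).symm.trans hk, rfl⟩
  · rintro ⟨k, hk, rfl⟩
    exact ⟨⟨k, rfl⟩, (ncard_orb_orbitRep k).trans hk⟩

theorem minimalAction_range_frobHom : MinimalAction frobHom.range := by
  intro E hE horth
  obtain ⟨k, hk⟩ := exists_mem_orb_orbitRep hE
  obtain ⟨b, a, hab⟩ := exists_bil_explicitAction_pos k
  set q : Frob := ⟨Multiplicative.ofAdd a, Multiplicative.ofAdd b⟩
  have hq : frobHom q (orbitRep k) = explicitAction a b (orbitRep k) := frobHom_apply q _
  rw [orb_eq_of_mem hk] at horth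
  have h0 := horth _ (mem_orb_self _ _) _ (mem_orb_range.2 ⟨q, hq⟩)
  by_cases heq : orbitRep k = explicitAction a b (orbitRep k)
  · rw [← heq, (orbitRep_mem_Exc k).1] at hab
    omega
  · have := h0 heq
    omega

theorem frobHom_injective : Function.Injective frobHom := by
  refine (injective_iff_map_eq_one frobHom).2 fun q hq => ?_
  have h : explicitAction q.left.toAdd q.right.toAdd (orbitRep 9) = orbitRep 9 := by
    rw [← frobHom_apply, hq]
    rfl
  have key : ∀ a b, explicitAction a b (orbitRep 9) = orbitRep 9 → a = 0 ∧ b = 0 := by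
    decide +kernel
  obtain ⟨ha, hb⟩ := key _ _ h
  exact SemidirectProduct.ext ha hb

/-! ### Cohomology -/

/-- A function on the Frobenius group satisfies the cocycle identity on the subgroup `H`. -/
def IsCocycleOn (H : Subgroup Frob) (f : Frob → V) : Prop :=
  ∀ g ∈ H, ∀ h ∈ H, f (g * h) = frobHom g (f h) + f g

theorem frobHom_mul_apply (g h : Frob) (v : V) : frobHom (g * h) v = frobHom g (frobHom h v) := by
  rw [map_mul, LinearEquiv.mul_apply]

theorem frobHom_one_apply (v : V) : frobHom 1 v = v := by
  rw [map_one]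
  rfl

theorem frobHom_inv_apply_apply (g : Frob) (v : V) : frobHom g⁻¹ (frobHom g v) = v := by
  rw [← frobHom_mul_apply, inv_mul_cancel, frobHom_one_apply]

theorem frobHom_apply_inv_apply (g : Frob) (v : V) : frobHom g (frobHom g⁻¹ v) = v := by
  rw [← frobHom_mul_apply, mul_inv_cancel, frobHom_one_apply]

namespace IsCocycleOn

variable {H : Subgroup Frob} {f : Frob → V}

theorem map_one (hf : IsCocycleOn H f) : f 1 = 0 := by
  simpa [frobHom_one_apply] using hf 1 H.one_mem 1 H.one_mem

/-- The elements of `H` at which a cocycle agrees with the coboundary of `v`. -/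
def agree (hf : IsCocycleOn H f) (v : V) : Subgroup Frob where
  carrier := {g | g ∈ H ∧ f g = frobHom g v - v}
  one_mem' := ⟨H.one_mem, by rw [hf.map_one, frobHom_one_apply, sub_self]⟩
  mul_mem' := by
    rintro g h ⟨hg, hgv⟩ ⟨hh, hhv⟩
    refine ⟨H.mul_mem hg hh, ?_⟩
    rw [hf g hg h hh, hgv, hhv, frobHom_mul_apply, map_sub]
    abel
  inv_mem' := by
    rintro g ⟨hg, hgv⟩
    refine ⟨H.inv_mem hg, ?_⟩
    have h := hf g⁻¹ (H.inv_mem hg) g hg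
    rw [inv_mul_cancel, hf.map_one, hgv, map_sub, frobHom_inv_apply_apply] at h
    rw [eq_neg_of_add_eq_zero_right h.symm, neg_sub]

theorem sub_coboundary (hf : IsCocycleOn H f) (v : V) :
    IsCocycleOn H fun g => f g - (frobHom g v - v) := by
  intro g hg h hh
  simp only [hf g hg h hh, frobHom_mul_apply, map_sub]
  abel

theorem map_pow (hf : IsCocycleOn H f) {g : Frob} (hg : g ∈ H) (n : ℕ) :
    f (g ^ n) = ∑ i ∈ Finset.range n, frobHom (g ^ i) (f g) := by
  induction n with
  | zero => simp [hf.map_one]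
  | succ n ih => rw [pow_succ, hf _ (H.pow_mem hg n) g hg, ih, Finset.sum_range_succ, add_comm]

end IsCocycleOn

/-- The generator of the normal subgroup of order `5`. -/
def rotElt : Frob := SemidirectProduct.inl (Multiplicative.ofAdd 1)

/-- The generator of the complement of order `4`. -/
def twistElt : Frob := SemidirectProduct.inr (Multiplicative.ofAdd 1)

theorem frobHom_rotElt : frobHom rotElt = rot := by
  simp only [frobHom, rotElt, SemidirectProduct.lift_inl]
  rfl

theorem frobHom_twistElt : frobHom twistElt = twist := by
  simp only [frobHom, twistElt, SemidirectProduct.lift_inr]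
  rfl

theorem exists_inl_pow_eq_rotElt {n : Multiplicative (ZMod 5)} (hn : n ≠ 1) :
    ∃ m : ℕ, (SemidirectProduct.inl n : Frob) ^ m = rotElt := by
  have : ∀ n : Multiplicative (ZMod 5), n ≠ 1 → ∃ m : Fin 5, n ^ m.1 = Multiplicative.ofAdd 1 := by
    decide
  obtain ⟨m, hm⟩ := this n hn
  exact ⟨m, by rw [← map_pow, hm, rotElt]⟩

theorem inl_eq_rotElt_pow (n : Multiplicative (ZMod 5)) :
    (SemidirectProduct.inl n : Frob) = rotElt ^ n.toAdd.val := by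
  have : ∀ n : Multiplicative (ZMod 5), Multiplicative.ofAdd (1 : ZMod 5) ^ n.toAdd.val = n := by
    decide
  rw [rotElt, ← map_pow, this]

/-- A strong form of the vanishing of the first cohomology of the group generated by an element `g`
with `g ^ 4 = 1`: the primitive can be chosen with at least the same symmetry under the normal
subgroup of order `5`. -/
def HasPrimitives (g : Frob) : Prop :=
  ∀ x : V, ∑ i ∈ Finset.range 4, frobHom (g ^ i) x = 0 → ∃ v, frobHom g v - v = x ∧
    ∀ n, frobHom (SemidirectProduct.inl n) x = x → frobHom (SemidirectProduct.inl n) v = v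

theorem frobHom_pow_apply_eq_self {g : Frob} {x : V} (h : frobHom g x = x) (m : ℕ) :
    frobHom (g ^ m) x = x := by
  induction m with
  | zero => exact frobHom_one_apply x
  | succ m ih => rw [pow_succ, frobHom_mul_apply, h, ih]

theorem frobHom_inl_fixes {x v : V} (h : rot x = x → rot v = v) (n : Multiplicative (ZMod 5))
    (hx : frobHom (SemidirectProduct.inl n) x = x) : frobHom (SemidirectProduct.inl n) v = v := by
  by_cases hn : n = 1
  · rw [hn, map_one, frobHom_one_apply]
  · obtain ⟨m, hm⟩ := exists_inl_pow_eq_rotElt hn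
    have hrot := frobHom_pow_apply_eq_self hx m
    rw [hm, frobHom_rotElt] at hrot
    rw [inl_eq_rotElt_pow]
    exact frobHom_pow_apply_eq_self (by rw [frobHom_rotElt, h hrot]) _

theorem hasPrimitives_one : HasPrimitives 1 := by
  intro x hx
  refine ⟨0, ?_, fun n _ => map_zero _⟩
  ext i
  have := congrFun hx i
  simp at this
  simp [this]

theorem hasPrimitives_twistElt : HasPrimitives twistElt := by
  intro x hx
  simp only [Finset.sum_range_succ, Finset.sum_range_zero, map_pow, frobHom_twistElt] at hx
  have h3 : twist ^ 3 = twist⁻¹ := eq_inv_of_mul_eq_one_left twist_pow_four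
  rw [h3] at hx
  have e := congrFun hx
  simp only [Pi.add_apply, Pi.zero_apply] at e
  have e0 := e 0; have e1 := e 1; have e2 := e 2; have e3 := e 3; have e4 := e 4
  have e5 := e 5; have e6 := e 6; have e7 := e 7; have e8 := e 8
  simp [twist_apply, twist_sq_apply, twist_inv_apply] at e0 e1 e2 e3 e4 e5 e6 e7 e8
  set w := -x 0 - x 2 - x 4 - x 5
  refine ⟨![0, -x 2 - 2 * w, w, w, w + x 2 - x 4, w + x 2 - x 5 - x 4 + x 6, w + x 4 - x 6,
    x 8, 0], ?_, frobHom_inl_fixes fun h => ?_⟩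
  · rw [frobHom_twistElt]
    ext i
    fin_cases i <;> simp [twist_apply] <;> omega
  · have f := congrFun h
    have f3 : x 2 = x 3 := f 3
    have f4 : x 3 = x 4 := f 4
    have f5 : x 4 = x 5 := f 5
    have f6 : x 5 = x 6 := f 6
    rw [rot_apply]
    simp [← f6, ← f5, ← f4, ← f3]

theorem hasPrimitives_twistElt_sq : HasPrimitives (twistElt ^ 2) := by
  intro x hx
  have h4 : (twist ^ 2) ^ 2 = 1 := by rw [← pow_mul, twist_pow_four]
  have h6 : (twist ^ 2) ^ 3 = twist ^ 2 := by rw [pow_succ, h4, one_mul]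
  simp only [Finset.sum_range_succ, Finset.sum_range_zero, map_pow, frobHom_twistElt, h4, h6] at hx
  have e := congrFun hx
  simp only [Pi.add_apply, Pi.zero_apply] at e
  have e0 := e 0; have e1 := e 1; have e2 := e 2; have e3 := e 3; have e4 := e 4
  have e5 := e 5; have e6 := e 6; have e7 := e 7; have e8 := e 8
  simp [twist_sq_apply] at e0 e1 e2 e3 e4 e5 e6 e7 e8
  refine ⟨![0, -x 7, 0, -x 3, -x 4, 0, 0, 0, x 0 + x 7], ?_, frobHom_inl_fixes fun h => ?_⟩
  · rw [map_pow, frobHom_twistElt]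
    ext i
    fin_cases i <;> simp [twist_sq_apply] <;> omega
  · have f := congrFun h
    have f2 := f 2; have f3 := f 3; have f4 := f 4; have f5 := f 5; have f6 := f 6
    simp [rot_apply] at f2 f3 f4 f5 f6
    ext i
    fin_cases i <;> simp [rot_apply] <;> omega

theorem exists_rot_primitive (x : V)
    (hx : ∑ i ∈ Finset.range 5, frobHom (rotElt ^ i) x = 0) : ∃ v, rot v - v = x := by
  simp only [Finset.sum_range_succ, Finset.sum_range_zero, map_pow, frobHom_rotElt] at hx
  have e := congrFun hx
  simp only [Pi.add_apply, Pi.zero_apply] at e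
  have e0 := e 0; have e1 := e 1; have e2 := e 2; have e7 := e 7; have e8 := e 8
  simp [rot_apply, pow_succ, LinearEquiv.mul_apply] at e0 e1 e2 e7 e8
  refine ⟨![0, 0, 0, -x 3, -x 3 - x 4, -x 3 - x 4 - x 5, x 2, 0, 0], ?_⟩
  ext i
  fin_cases i <;> simp [rot_apply] <;> omega

theorem HasPrimitives.conj {g : Frob} (hg : HasPrimitives g) (c : Frob) :
    HasPrimitives (c * g * c⁻¹) := by
  intro x hx
  obtain ⟨v, hv, hinv⟩ := hg (frobHom c⁻¹ x) <| by
    have := congrArg (frobHom c⁻¹) hx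
    rw [map_sum, map_zero] at this
    rw [← this]
    refine Finset.sum_congr rfl fun i _ => ?_
    rw [conj_pow, ← frobHom_mul_apply, ← frobHom_mul_apply]
    congr 2
    group
  refine ⟨frobHom c v, ?_, fun n hn => ?_⟩
  · rw [frobHom_mul_apply, frobHom_mul_apply, frobHom_inv_apply_apply, ← map_sub, hv,
      frobHom_apply_inv_apply]
  · obtain ⟨m, hm⟩ : ∃ m, SemidirectProduct.inl m = c⁻¹ * SemidirectProduct.inl n * c := by
      refine SemidirectProduct.range_inl_eq_ker_rightHom.ge ?_
      simp [MonoidHom.mem_ker]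
    have hm' : SemidirectProduct.inl n * c = c * SemidirectProduct.inl m := by rw [hm]; group
    rw [← frobHom_mul_apply, hm', frobHom_mul_apply, hinv m]
    rw [hm, ← frobHom_mul_apply, mul_assoc, mul_inv_cancel, mul_one, frobHom_mul_apply, hn]

theorem exists_conj_twistElt_eq {g : Frob} (hg : g.right = Multiplicative.ofAdd 1) :
    ∃ c, g = c * twistElt * c⁻¹ := by
  have key : ∀ a, ∃ d, (⟨a, Multiplicative.ofAdd 1⟩ : Frob) =
      SemidirectProduct.inl d * twistElt * (SemidirectProduct.inl d)⁻¹ := by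
    decide
  obtain ⟨a, b⟩ := g
  obtain ⟨d, hd⟩ := key a
  exact ⟨_, by rw [← hd]; exact SemidirectProduct.ext rfl hg⟩

theorem exists_conj_twistElt_sq_eq {g : Frob} (hg : g.right = Multiplicative.ofAdd 2) :
    ∃ c, g = c * twistElt ^ 2 * c⁻¹ := by
  have key : ∀ a, ∃ d, (⟨a, Multiplicative.ofAdd 2⟩ : Frob) =
      SemidirectProduct.inl d * twistElt ^ 2 * (SemidirectProduct.inl d)⁻¹ := by
    decide
  obtain ⟨a, b⟩ := g
  obtain ⟨d, hd⟩ := key a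
  exact ⟨_, by rw [← hd]; exact SemidirectProduct.ext rfl hg⟩

theorem right_mul_pow (g h : Frob) (m : ℕ) : (h * g ^ m).right = h.right * g.right ^ m := by
  simpa using map_pow SemidirectProduct.rightHom g m

/-- A subgroup of the Frobenius group is generated by its intersection with the normal subgroup of
order `5` and an element of order dividing `4`, for which primitives exist. -/
theorem exists_transversal_generator (H : Subgroup Frob) :
    ∃ g ∈ H, HasPrimitives g ∧ g ^ 4 = 1 ∧ ∀ h ∈ H, ∃ m : ℕ, (h * g ^ m).right = 1 := by
  have htwist : twistElt ^ 4 = 1 := rfl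
  by_cases h₁ : ∃ g ∈ H, g.right = Multiplicative.ofAdd 1
  · obtain ⟨g, hg, hgr⟩ := h₁
    obtain ⟨c, hc⟩ := exists_conj_twistElt_eq hgr
    refine ⟨g, hg, hc ▸ hasPrimitives_twistElt.conj c, by rw [hc, conj_pow, htwist]; simp, ?_⟩
    intro h _
    have key : ∀ b : Multiplicative (ZMod 4), ∃ m : Fin 4,
        b * Multiplicative.ofAdd 1 ^ m.1 = 1 := by
      decide
    obtain ⟨m, hm⟩ := key h.right
    exact ⟨m, by rw [right_mul_pow, hgr, hm]⟩
  have hne (h) (hh : h ∈ H) : h.right = 1 ∨ h.right = Multiplicative.ofAdd 2 := by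
    have key : ∀ b : Multiplicative (ZMod 4), b ≠ Multiplicative.ofAdd 1 →
        b⁻¹ ≠ Multiplicative.ofAdd 1 → b = 1 ∨ b = Multiplicative.ofAdd 2 := by
      decide
    refine key _ (fun hr => h₁ ⟨h, hh, hr⟩) fun hr => h₁ ⟨h⁻¹, H.inv_mem hh, ?_⟩
    rw [SemidirectProduct.inv_right, hr]
  by_cases h₂ : ∃ g ∈ H, g.right = Multiplicative.ofAdd 2
  · obtain ⟨g, hg, hgr⟩ := h₂
    obtain ⟨c, hc⟩ := exists_conj_twistElt_sq_eq hgr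
    refine ⟨g, hg, hc ▸ hasPrimitives_twistElt_sq.conj c, ?_, fun h hh => ?_⟩
    · rw [hc, conj_pow, pow_right_comm, htwist]
      simp
    · rcases hne h hh with hr | hr
      · exact ⟨0, by simp [hr]⟩
      · exact ⟨1, by rw [right_mul_pow, hgr, hr]; rfl⟩
  · refine ⟨1, H.one_mem, hasPrimitives_one, one_pow 4, fun h hh => ⟨0, ?_⟩⟩
    rw [pow_zero, mul_one]
    exact (hne h hh).resolve_right fun hr => h₂ ⟨h, hh, hr⟩

theorem IsCocycleOn.exists_eq_coboundary {H : Subgroup Frob} {f : Frob → V}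
    (hf : IsCocycleOn H f) : ∃ v, ∀ g ∈ H, f g = frobHom g v - v := by
  obtain ⟨w, hw⟩ : ∃ w, ∀ n, SemidirectProduct.inl n ∈ H →
      f (SemidirectProduct.inl n) = frobHom (SemidirectProduct.inl n) w - w := by
    by_cases hrot : rotElt ∈ H
    · obtain ⟨w, hw⟩ := exists_rot_primitive (f rotElt) <| by
        rw [← hf.map_pow hrot, show rotElt ^ 5 = 1 from rfl, hf.map_one]
      refine ⟨w, fun n _ => ?_⟩
      have : rotElt ∈ hf.agree w := ⟨hrot, by rw [frobHom_rotElt, hw]⟩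
      rw [inl_eq_rotElt_pow]
      exact (pow_mem this _ : _ ∈ hf.agree w).2
    · refine ⟨0, fun n hn => ?_⟩
      obtain rfl : n = 1 := by
        by_contra hne
        obtain ⟨m, hm⟩ := exists_inl_pow_eq_rotElt hne
        exact hrot (hm ▸ H.pow_mem hn m)
      simp [hf.map_one]
  have hf' := hf.sub_coboundary w
  set f' : Frob → V := fun g => f g - (frobHom g w - w) with hf'def
  have hzero (n) (hn : SemidirectProduct.inl n ∈ H) : f' (SemidirectProduct.inl n) = 0 :=
    sub_eq_zero.2 (hw n hn)
  obtain ⟨g, hg, hprim, hg4, htrans⟩ := exists_transversal_generator H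
  obtain ⟨v, hv, hinv⟩ := hprim (f' g) <| by rw [← hf'.map_pow hg, hg4, hf'.map_one]
  refine ⟨v + w, fun h hh => ?_⟩
  suffices h ∈ hf'.agree v by
    have := this.2
    simp only [hf'def] at this
    rw [map_add, ← sub_eq_zero]
    rw [← sub_eq_zero] at this
    rw [← this]
    abel
  have hgv : g ∈ hf'.agree v := ⟨hg, hv.symm⟩
  obtain ⟨m, hm⟩ := htrans h hh
  obtain ⟨n, hn⟩ : ∃ n, SemidirectProduct.inl n = h * g ^ m :=
    SemidirectProduct.range_inl_eq_ker_rightHom.ge hm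
  have hnH : SemidirectProduct.inl n ∈ H := hn ▸ H.mul_mem hh (H.pow_mem hg m)
  obtain ⟨n', hn'⟩ : ∃ n', SemidirectProduct.inl n' = g⁻¹ * SemidirectProduct.inl n * g := by
    refine SemidirectProduct.range_inl_eq_ker_rightHom.ge ?_
    simp [MonoidHom.mem_ker]
  have hn'H : SemidirectProduct.inl n' ∈ H :=
    hn' ▸ H.mul_mem (H.mul_mem (H.inv_mem hg) hnH) hg
  have hfix : frobHom (SemidirectProduct.inl n) (f' g) = f' g := by
    have h₁ := hf' _ hnH g hg
    have h₂ := hf' g hg _ hn'H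
    rw [hzero n hnH, add_zero] at h₁
    rw [hzero n' hn'H, map_zero, zero_add, hn', mul_assoc, mul_inv_cancel_left] at h₂
    exact h₁.symm.trans h₂
  have hnv : SemidirectProduct.inl n ∈ hf'.agree v :=
    ⟨hnH, by rw [hzero n hnH, hinv n hfix, sub_self]⟩
  rw [hn] at hnv
  exact (mul_mem_cancel_right (pow_mem hgv m)).1 hnv

theorem condH1_range_frobHom : CondH1 frobHom.range := by
  classical
  intro G' hG'
  refine ⟨fun a b => ?_⟩
  suffices h : ∀ c : groupCohomology.H1 (Rep.of (rep G')), c = 0 by rw [h a, h b]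
  intro c
  induction c using groupCohomology.H1_induction_on with | _ c =>
  rw [groupCohomology.H1π_eq_zero_iff]
  have hc := (groupCohomology.mem_cocycles₁_iff _).1 c.2
  have hf : IsCocycleOn (G'.comap frobHom) fun q =>
      if hq : frobHom q ∈ G' then c ⟨frobHom q, hq⟩ else 0 := by
    intro g hg h hh
    have hgh : frobHom (g * h) ∈ G' := (G'.comap frobHom).mul_mem hg hh
    simp only [dif_pos (show frobHom g ∈ G' from hg), dif_pos (show frobHom h ∈ G' from hh),
      dif_pos hgh]
    exact (congrArg c (Subtype.ext (map_mul frobHom g h))).trans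
      (hc ⟨frobHom g, hg⟩ ⟨frobHom h, hh⟩)
  obtain ⟨v, hv⟩ := hf.exists_eq_coboundary
  refine ⟨v, funext fun g => ?_⟩
  obtain ⟨q, hq⟩ := hG' g.2
  have hqG : frobHom q ∈ G' := hq ▸ g.2
  have := hv q hqG
  rw [dif_pos hqG] at this
  have hgq : g = ⟨frobHom q, hqG⟩ := Subtype.ext hq.symm
  rw [hgq]
  exact this.symm

theorem exists_dp1_F5_conic :
    ∃ G : Subgroup LatAut, G ≤ W ∧
      (∃ ψ : Multiplicative (ZMod 4) →* MulAut (Multiplicative (ZMod 5)),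
        Function.Injective ψ ∧
        Nonempty (G ≃* (Multiplicative (ZMod 5) ⋊[ψ] Multiplicative (ZMod 4)))) ∧
      (orbs G).ncard = 18 ∧
      {S ∈ orbs G | S.ncard = 4}.ncard = 5 ∧
      {S ∈ orbs G | S.ncard = 10}.ncard = 4 ∧
      {S ∈ orbs G | S.ncard = 20}.ncard = 9 ∧
      MinimalAction G ∧
      (∃ C, IsConic C ∧ ∀ g ∈ G, g C = C) ∧
      CondH1 G := by
  refine ⟨frobHom.range, fun g hg => (range_frobHom_le_stab hg).1,
    ⟨doubling, doubling_injective, ⟨(frobHom.ofInjective frobHom_injective).symm⟩⟩,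
    ncard_orbs, ?_, ?_, ?_, minimalAction_range_frobHom,
    ⟨conic, isConic_conic, fun g hg => (range_frobHom_le_stab hg).2⟩,
    condH1_range_frobHom⟩
  · rw [ncard_orbs_of_size]; decide
  · rw [ncard_orbs_of_size]; decide
  · rw [ncard_orbs_of_size]; decide

end
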